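/- Let m = 2 and n ≥ 2, and let ξ ∈ ℝ^{n×2} be totally irrational with best approximation sequences (X_i), (L_i). If sup_{i≥1} L_i/L_{i+1} < ∞ (Property (C)), then the ordinary exponent satisfies ω(ξ) ≤ 2. -/

import Mathlib

open Filter

/-- The sup-norm of the `i`-th integer vector `x i`, viewed in `ℝ^m`. -/
noncomputable def Xval {m : ℕ} (x : ℕ → Fin m → ℤ) (i : ℕ) : ℝ :=
  ‖(fun j => (x i j : ℝ))‖

/-- The sup-norm of the remainder `ξ 𝒙ᵢ − 𝒚ᵢ`. -/
noncomputable def Lval {m n : ℕ} (ξ : Matrix (Fin n) (Fin m) ℝ)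
    (x : ℕ → Fin m → ℤ) (y : ℕ → Fin n → ℤ) (i : ℕ) : ℝ :=
  ‖(ξ.mulVec (fun j => (x i j : ℝ)) - (fun k => (y i k : ℝ)))‖

/-- `ξ` is totally irrational: `‖ξ𝒙 − 𝒚‖ > 0` for every nonzero integer pair `(𝒙,𝒚)`. -/
def TotallyIrrational {m n : ℕ} (ξ : Matrix (Fin n) (Fin m) ℝ) : Prop :=
  ∀ (u : Fin m → ℤ) (v : Fin n → ℤ), (u, v) ≠ 0 →
    0 < ‖(ξ.mulVec (fun j => (u j : ℝ)) - (fun k => (v k : ℝ)))‖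

/-- `(𝒙ᵢ, 𝒚ᵢ)_{i}` is a sequence of best approximation vectors for `ξ`
(with respect to the sup norms). -/
structure IsBestApproxSeq {m n : ℕ} (ξ : Matrix (Fin n) (Fin m) ℝ)
    (x : ℕ → Fin m → ℤ) (y : ℕ → Fin n → ℤ) : Prop where
  nonzero : ∀ i, x i ≠ 0
  first : Xval x 0 = 1
  xStrictMono : StrictMono (Xval x)
  lStrictAnti : StrictAnti (Lval ξ x y)
  best : ∀ (i : ℕ) (u : Fin m → ℤ) (v : Fin n → ℤ), u ≠ 0 →
    ‖(fun j => (u j : ℝ))‖ < Xval x (i + 1) →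
    Lval ξ x y i ≤ ‖(ξ.mulVec (fun j => (u j : ℝ)) - (fun k => (v k : ℝ)))‖

/-- Property (A): `ξ` is badly approximable. -/
def PropA {m n : ℕ} (ξ : Matrix (Fin n) (Fin m) ℝ) : Prop :=
  ∃ c : ℝ, 0 < c ∧ ∀ (u : Fin m → ℤ) (v : Fin n → ℤ), u ≠ 0 →
    c ≤ ‖(fun j => (u j : ℝ))‖ ^ m *
        ‖(ξ.mulVec (fun j => (u j : ℝ)) - (fun k => (v k : ℝ)))‖ ^ n

/-- Property (B): the ratios `X_{i+1}/X_i` are bounded. -/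
def PropB {m : ℕ} (x : ℕ → Fin m → ℤ) : Prop :=
  ∃ M : ℝ, ∀ i : ℕ, Xval x (i + 1) / Xval x i ≤ M

/-- Property (C): the ratios `L_i/L_{i+1}` are bounded. -/
def PropC {m n : ℕ} (ξ : Matrix (Fin n) (Fin m) ℝ)
    (x : ℕ → Fin m → ℤ) (y : ℕ → Fin n → ℤ) : Prop :=
  ∃ M : ℝ, ∀ i : ℕ, Lval ξ x y i / Lval ξ x y (i + 1) ≤ M

/-- The ordinary exponent `ω(ξ) = limsup (−log Lᵢ)/(log Xᵢ)`, as a value in `[0,+∞]`. -/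
noncomputable def ordExp {m n : ℕ} (ξ : Matrix (Fin n) (Fin m) ℝ)
    (x : ℕ → Fin m → ℤ) (y : ℕ → Fin n → ℤ) : EReal :=
  limsup (fun i => ((-Real.log (Lval ξ x y i) / Real.log (Xval x i) : ℝ) : EReal)) atTop

/-- The uniform exponent `ω̂(ξ) = liminf (−log Lᵢ)/(log X_{i+1})`, as a value in `[0,+∞]`. -/
noncomputable def unifExp {m n : ℕ} (ξ : Matrix (Fin n) (Fin m) ℝ)
    (x : ℕ → Fin m → ℤ) (y : ℕ → Fin n → ℤ) : EReal :=
  liminf (fun i => ((-Real.log (Lval ξ x y i) / Real.log (Xval x (i + 1)) : ℝ) : EReal)) atTop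

section Auxiliary

/-- The sup norm of a nonempty finite real vector is attained at some coordinate. -/
lemma exists_abs_eq_pi_norm {ι : Type*} [Fintype ι] [Nonempty ι] (f : ι → ℝ) :
    ∃ k, |f k| = ‖f‖ := by
  obtain ⟨k, hk⟩ := Finite.exists_max fun k => |f k|
  refine ⟨k, le_antisymm (norm_le_pi_norm f k) ?_⟩
  exact (pi_norm_le_iff_of_nonneg (abs_nonneg _)).2 hk

lemma abs_apply_le_pi_norm {ι : Type*} [Fintype ι] (f : ι → ℝ) (k : ι) : |f k| ≤ ‖f‖ :=
  norm_le_pi_norm f k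

/-- If `a` and `a'` have the same sign and `a * r' - a' * r` is small, then so is `r' - r`. -/
lemma abs_sub_lt_of_abs_cross_le {P Q δ a a' r r' : ℝ} (hP : 0 < P) (ha' : |a'| = P)
    (hδ : 3 * δ < P * Q) (hsign : 0 < a * a') (haP : |a| ≤ P) (haQ : P * Q - δ ≤ |a| * Q)
    (hr' : |r'| ≤ Q) (h : |a * r' - a' * r| ≤ δ) : |r' - r| < Q := by
  have hdiff : |a' - a| = P - |a| := by
    rcases pos_and_pos_or_neg_and_neg_of_mul_pos hsign with ⟨h1, h2⟩ | ⟨h1, h2⟩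
    · rw [abs_of_pos h1] at *
      rw [abs_of_pos h2] at ha'
      rw [abs_of_nonneg] <;> linarith
    · rw [abs_of_neg h1] at *
      rw [abs_of_neg h2] at ha'
      rw [abs_of_nonpos] <;> linarith
  have hδ0 : 0 ≤ δ := (abs_nonneg _).trans h
  have key : P * |r' - r| ≤ δ + (P - |a|) * Q := by
    calc P * |r' - r| = |(a * r' - a' * r) + (a' - a) * r'| := by
          rw [← ha', ← abs_mul]; congr 1; ring
      _ ≤ |a * r' - a' * r| + |(a' - a) * r'| := abs_add_le _ _
      _ ≤ δ + (P - |a|) * Q := by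
          rw [abs_mul, hdiff]
          gcongr
  have : P * |r' - r| < P * Q := by nlinarith
  exact lt_of_mul_lt_mul_left this hP.le

/-- If all the cross differences `x s * r' k - x' s * r k` are small compared with `‖x'‖ * ‖r‖`,
then `(x', r')` is close to `(x, r)` or to `(-x, -r)`. -/
lemma near_or_near_neg_of_abs_cross_le {ι κ : Type*} [Fintype ι] [Nonempty ι] [Fintype κ]
    [Nonempty κ] (x x' : ι → ℝ) (r r' : κ → ℝ) {δ : ℝ} (hP : 0 < ‖x'‖) (hQ : 0 < ‖r‖)
    (hx : ‖x‖ ≤ ‖x'‖) (hr : ‖r'‖ ≤ ‖r‖) (hδ : 3 * δ < ‖x'‖ * ‖r‖)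
    (h : ∀ s k, |x s * r' k - x' s * r k| ≤ δ) :
    (‖x' - x‖ < ‖x'‖ ∧ ‖r' - r‖ < ‖r‖) ∨ (‖x' + x‖ < ‖x'‖ ∧ ‖r' + r‖ < ‖r‖) := by
  obtain ⟨s, hs⟩ := exists_abs_eq_pi_norm x'
  obtain ⟨k, hk⟩ := exists_abs_eq_pi_norm r
  have bx : ∀ t, |x t| ≤ ‖x'‖ := fun t => (abs_apply_le_pi_norm x t).trans hx
  have br : ∀ t, |r' t| ≤ ‖r‖ := fun t => (abs_apply_le_pi_norm r' t).trans hr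
  generalize ‖x'‖ = P at *
  generalize ‖r‖ = Q at *
  have hδ0 : 0 ≤ δ := (abs_nonneg _).trans (h s k)
  have hbig : P * Q - δ ≤ |x s| * |r' k| := by
    have h1 := abs_sub_abs_le_abs_sub (x' s * r k) (x s * r' k)
    rw [abs_sub_comm, abs_mul, abs_mul, hs, hk] at h1
    linarith [h s k]
  have hsQ : P * Q - δ ≤ |x s| * Q :=
    hbig.trans (mul_le_mul_of_nonneg_left (br k) (abs_nonneg _))
  have hkP : Q * P - δ ≤ |r' k| * P := by
    have := hbig.trans (mul_le_mul_of_nonneg_right (bx s) (abs_nonneg _))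
    linarith [mul_comm P Q, mul_comm P |r' k|]
  have hsign : 0 < (x s * x' s) * (r' k * r k) := by
    by_contra! hneg
    have hsq : (x s * r' k) * (x' s * r k) ≤ 0 := by linarith
    have h2 := sq_le_sq' (abs_le.1 (h s k)).1 (abs_le.1 (h s k)).2
    have h3 : (x' s * r k) ^ 2 = (P * Q) ^ 2 := by
      rw [← sq_abs, abs_mul, hs, hk]
    nlinarith [sq_nonneg (x s * r' k), mul_pos hP hQ]
  rcases pos_and_pos_or_neg_and_neg_of_mul_pos hsign with ⟨h1, h2⟩ | ⟨h1, h2⟩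
  · left
    rw [pi_norm_lt_iff hP, pi_norm_lt_iff hQ]
    refine ⟨fun t => ?_, fun t => ?_⟩
    · rw [Pi.sub_apply, Real.norm_eq_abs, abs_sub_comm]
      refine abs_sub_lt_of_abs_cross_le hQ hk (by linarith) h2 (br k) hkP (bx t) ?_
      rw [mul_comm, mul_comm (r k)]
      exact h t k
    · exact abs_sub_lt_of_abs_cross_le hP hs hδ h1 (bx s) hsQ (br t) (h s t)
  · right
    rw [pi_norm_lt_iff hP, pi_norm_lt_iff hQ]
    refine ⟨fun t => ?_, fun t => ?_⟩
    · have := abs_sub_lt_of_abs_cross_le (a := r' k) (a' := -r k) (r := x' t) (r' := -x t)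
        (δ := δ) hQ (by rwa [abs_neg]) (by linarith) (by linarith) (br k) hkP
        (by rw [abs_neg]; exact bx t) ?_
      · rwa [Pi.add_apply, Real.norm_eq_abs, ← abs_neg, neg_add_rev, ← sub_eq_add_neg]
      · rw [← abs_neg]
        convert h t k using 2
        ring
    · have := abs_sub_lt_of_abs_cross_le (a := -x s) (a' := x' s) (r := -r t) (r' := r' t)
        (δ := δ) hP hs hδ (by linarith) (by rw [abs_neg]; exact bx s)
        (by rwa [abs_neg]) (br t) ?_
      · rwa [sub_neg_eq_add] at this
      · rw [← abs_neg]
        convert h s t using 2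
        ring

/-- The remainder `ξ 𝒙 − 𝒚` of an integer pair `(𝒙, 𝒚)`. -/
noncomputable def remainder {m n : ℕ} (ξ : Matrix (Fin n) (Fin m) ℝ) (u : Fin m → ℤ)
    (v : Fin n → ℤ) : Fin n → ℝ :=
  ξ.mulVec (fun j => (u j : ℝ)) - (fun k => (v k : ℝ))

lemma remainder_apply {m n : ℕ} (ξ : Matrix (Fin n) (Fin m) ℝ) (u : Fin m → ℤ)
    (v : Fin n → ℤ) (k : Fin n) : remainder ξ u v k = ∑ j, ξ k j * (u j : ℝ) - v k := rfl

/-- An integer, written as a combination of remainders whose `𝒙`-parts cancel, vanishes if it is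
smaller than one in absolute value. -/
lemma remainder_combination_eq_zero {n : ℕ} (ξ : Matrix (Fin n) (Fin 2) ℝ)
    {a b c : ℤ} {u₁ u₂ u₃ : Fin 2 → ℤ} {v₁ v₂ v₃ : Fin n → ℤ}
    (hu : ∀ s, a * u₁ s + b * u₂ s + c * u₃ s = 0) (k : Fin n)
    (hlt : |(a : ℝ) * remainder ξ u₁ v₁ k + b * remainder ξ u₂ v₂ k
      + c * remainder ξ u₃ v₃ k| < 1) :
    (a : ℝ) * remainder ξ u₁ v₁ k + b * remainder ξ u₂ v₂ k + c * remainder ξ u₃ v₃ k = 0 := by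
  have hint : (a : ℝ) * remainder ξ u₁ v₁ k + b * remainder ξ u₂ v₂ k
      + c * remainder ξ u₃ v₃ k = ((-(a * v₁ k + b * v₂ k + c * v₃ k) : ℤ) : ℝ) := by
    have h0 : (a : ℝ) * u₁ 0 + b * u₂ 0 + c * u₃ 0 = 0 := by exact_mod_cast hu 0
    have h1 : (a : ℝ) * u₁ 1 + b * u₂ 1 + c * u₃ 1 = 0 := by exact_mod_cast hu 1
    simp only [remainder_apply, Fin.sum_univ_two]
    push_cast
    linear_combination ξ k 0 * h0 + ξ k 1 * h1
  rw [hint] at hlt ⊢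
  rw [← Int.cast_abs, ← Int.cast_one, Int.cast_lt, Int.abs_lt_one_iff] at hlt
  rw [hlt, Int.cast_zero]

namespace IsBestApproxSeq

section General

variable {m n : ℕ} {ξ : Matrix (Fin n) (Fin m) ℝ} {x : ℕ → Fin m → ℤ} {y : ℕ → Fin n → ℤ}

lemma one_le_Xval (h : IsBestApproxSeq ξ x y) (i : ℕ) : 1 ≤ Xval x i := by
  rw [← h.first]
  exact h.xStrictMono.monotone (Nat.zero_le i)

lemma Lval_pos (h : IsBestApproxSeq ξ x y) (i : ℕ) : 0 < Lval ξ x y i :=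
  (norm_nonneg _).trans_lt (h.lStrictAnti (Nat.lt_succ_self i))

lemma abs_coord_le (_h : IsBestApproxSeq ξ x y) (i : ℕ) (s : Fin m) :
    |(x i s : ℝ)| ≤ Xval x i :=
  abs_apply_le_pi_norm (fun j => (x i j : ℝ)) s

lemma abs_remainder_le (_h : IsBestApproxSeq ξ x y) (i : ℕ) (k : Fin n) :
    |remainder ξ (x i) (y i) k| ≤ Lval ξ x y i :=
  abs_apply_le_pi_norm (remainder ξ (x i) (y i)) k

lemma exists_abs_coord_eq (h : IsBestApproxSeq ξ x y) (i : ℕ) :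
    ∃ s, |(x i s : ℝ)| = Xval x i := by
  have : Nonempty (Fin m) := by
    by_contra hne
    rw [not_nonempty_iff] at hne
    exact h.nonzero i (Subsingleton.elim _ _)
  exact exists_abs_eq_pi_norm _

lemma exists_abs_remainder_eq [Nonempty (Fin n)] (_h : IsBestApproxSeq ξ x y) (i : ℕ) :
    ∃ k, |remainder ξ (x i) (y i) k| = Lval ξ x y i :=
  exists_abs_eq_pi_norm (remainder ξ (x i) (y i))

lemma tendsto_Xval (h : IsBestApproxSeq ξ x y) : Tendsto (Xval x) atTop atTop := by
  have hX : ∀ i, ∃ N : ℕ, (N : ℝ) = Xval x i := fun i => by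
    obtain ⟨s, hs⟩ := h.exists_abs_coord_eq i
    exact ⟨(x i s).natAbs, by rw [← hs, Nat.cast_natAbs, Int.cast_abs]⟩
  choose N hN using hX
  have hmono : StrictMono N := fun i j hij => by
    have := h.xStrictMono hij
    rw [← hN, ← hN] at this
    exact_mod_cast this
  have := tendsto_natCast_atTop_atTop (R := ℝ).comp hmono.tendsto_atTop
  exact this.congr hN

/-- An integer pair with small `𝒙`-part and small remainder has zero `𝒙`-part. -/
lemma eq_zero_of_lt (h : IsBestApproxSeq ξ x y) (i : ℕ) (u : Fin m → ℤ) (v : Fin n → ℤ)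
    (hu : ‖(fun j => (u j : ℝ))‖ < Xval x (i + 1)) (hL : ‖remainder ξ u v‖ < Lval ξ x y i) :
    u = 0 := by
  by_contra hne
  exact absurd (h.best i u v hne hu) (not_le.2 hL)

/-- The wedge product of consecutive best approximations is of size at least
`L_j X_{j+1} / 3`. -/
lemma Lval_mul_Xval_le [Nonempty (Fin n)] (h : IsBestApproxSeq ξ x y) (j : ℕ) {δ : ℝ}
    (hδ : ∀ s k, |(x j s : ℝ) * remainder ξ (x (j + 1)) (y (j + 1)) k
      - x (j + 1) s * remainder ξ (x j) (y j) k| ≤ δ) :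
    Xval x (j + 1) * Lval ξ x y j ≤ 3 * δ := by
  by_contra! hlt
  obtain ⟨s₀, hs₀⟩ := h.exists_abs_coord_eq j
  have : Nonempty (Fin m) := ⟨s₀⟩
  have hXlt : Xval x j < Xval x (j + 1) := h.xStrictMono (Nat.lt_succ_self j)
  rcases near_or_near_neg_of_abs_cross_le (fun s => (x j s : ℝ)) (fun s => (x (j + 1) s : ℝ))
    (remainder ξ (x j) (y j)) (remainder ξ (x (j + 1)) (y (j + 1)))
    (zero_lt_one.trans_le (h.one_le_Xval (j + 1))) (h.Lval_pos j) hXlt.le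
    (h.lStrictAnti (Nat.lt_succ_self j)).le hlt hδ with ⟨h1, h2⟩ | ⟨h1, h2⟩
  · have hz := h.eq_zero_of_lt j (x (j + 1) - x j) (y (j + 1) - y j)
      (by refine lt_of_eq_of_lt (congrArg norm ?_) h1; ext t; simp)
      (by
        refine lt_of_eq_of_lt (congrArg norm ?_) h2
        ext k
        simp only [remainder_apply, Pi.sub_apply, Int.cast_sub, mul_sub, Finset.sum_sub_distrib]
        ring)
    rw [sub_eq_zero] at hz
    rw [Xval, Xval, hz] at hXlt
    exact lt_irrefl _ hXlt
  · have hz := h.eq_zero_of_lt j (x (j + 1) + x j) (y (j + 1) + y j)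
      (by refine lt_of_eq_of_lt (congrArg norm ?_) h1; ext t; simp)
      (by
        refine lt_of_eq_of_lt (congrArg norm ?_) h2
        ext k
        simp only [remainder_apply, Pi.add_apply, Int.cast_add, mul_add, Finset.sum_add_distrib]
        ring)
    have hz' : ∀ s, x (j + 1) s = -x j s := fun s => eq_neg_of_add_eq_zero_left (congrFun hz s)
    have : Xval x (j + 1) = Xval x j := by
      rw [Xval, Xval, ← norm_neg]
      congr 1
      ext s
      simp [hz' s]
    linarith

end General

section Planar

variable {n : ℕ} {ξ : Matrix (Fin n) (Fin 2) ℝ} {x : ℕ → Fin 2 → ℤ} {y : ℕ → Fin n → ℤ}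

/-- Consecutive best approximations with small `L_j X_{j+1}` have independent `𝒙`-parts. -/
lemma det_ne_zero [Nonempty (Fin n)] (h : IsBestApproxSeq ξ x y) (j : ℕ)
    (hlt : 2 * (Xval x (j + 1) * Lval ξ x y j) < 1) :
    x j 0 * x (j + 1) 1 - x j 1 * x (j + 1) 0 ≠ 0 := by
  intro hdet
  have hX : Xval x j < Xval x (j + 1) := h.xStrictMono (Nat.lt_succ_self j)
  have hL : Lval ξ x y (j + 1) < Lval ξ x y j := h.lStrictAnti (Nat.lt_succ_self j)
  have hX1 := h.one_le_Xval j
  have hLp := h.Lval_pos (j + 1)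
  obtain ⟨s, hs⟩ := h.exists_abs_coord_eq (j + 1)
  obtain ⟨k, hk⟩ := h.exists_abs_remainder_eq j
  have hcomb : ∀ t, x (j + 1) s * x j t + -x j s * x (j + 1) t + 0 * x j t = 0 := by
    intro t
    fin_cases s <;> fin_cases t <;> simp <;> linarith
  have hprod : |(x j s : ℝ) * remainder ξ (x (j + 1)) (y (j + 1)) k|
      ≤ Xval x j * Lval ξ x y (j + 1) := by
    rw [abs_mul]
    exact mul_le_mul (h.abs_coord_le j s) (h.abs_remainder_le (j + 1) k) (abs_nonneg _)
      (by linarith)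
  have hlt' : Xval x j * Lval ξ x y (j + 1) < Xval x (j + 1) * Lval ξ x y j :=
    mul_lt_mul hX hL.le hLp (by linarith)
  have hmain : |(x (j + 1) s : ℝ) * remainder ξ (x j) (y j) k| = Xval x (j + 1) * Lval ξ x y j := by
    rw [abs_mul, hs, hk]
  have hzero := remainder_combination_eq_zero ξ (v₁ := y j) (v₂ := y (j + 1)) (v₃ := y j) hcomb k (by
    push_cast
    rw [zero_mul, add_zero, neg_mul, ← sub_eq_add_neg]
    refine (abs_sub _ _).trans_lt ?_
    linarith)
  push_cast at hzero
  rw [show (x (j + 1) s : ℝ) * remainder ξ (x j) (y j) k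
    = x j s * remainder ξ (x (j + 1)) (y (j + 1)) k by linarith] at hmain
  linarith

/-- The first coefficient of an integer vector written as a real combination of two consecutive
best approximations is an integer. -/
lemma exists_int_eq (h : IsBestApproxSeq ξ x y) (j : ℕ)
    (hdet : x j 0 * x (j + 1) 1 - x j 1 * x (j + 1) 0 ≠ 0) {u : Fin 2 → ℤ} {v : Fin n → ℤ}
    {p q : ℝ} (hu : ∀ s, (u s : ℝ) = p * x j s + q * x (j + 1) s)
    (hv : ∀ k, remainder ξ u v k = p * remainder ξ (x j) (y j) k
      + q * remainder ξ (x (j + 1)) (y (j + 1)) k) :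
    ∃ a : ℤ, (a : ℝ) = p := by
  have hX : Xval x j < Xval x (j + 1) := h.xStrictMono (Nat.lt_succ_self j)
  have hL : Lval ξ x y (j + 1) < Lval ξ x y j := h.lStrictAnti (Nat.lt_succ_self j)
  have hp := abs_sub_round p
  have hq := abs_sub_round q
  have hcombine : ∀ {α β a b A B : ℝ}, |α| ≤ 1 / 2 → |β| ≤ 1 / 2 → |a| ≤ A → |b| ≤ B →
      |α * a + β * b| ≤ (A + B) / 2 := by
    intro α β a b A B hα hβ ha hb
    have h1 : |α| * |a| ≤ 1 / 2 * A := mul_le_mul hα ha (abs_nonneg _) (by norm_num)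
    have h2 : |β| * |b| ≤ 1 / 2 * B := mul_le_mul hβ hb (abs_nonneg _) (by norm_num)
    have := abs_add_le (α * a) (β * b)
    rw [abs_mul, abs_mul] at this
    linarith
  have hu' : ∀ s, ((u s - round p * x j s - round q * x (j + 1) s : ℤ) : ℝ)
      = (p - round p) * x j s + (q - round q) * x (j + 1) s := by
    intro s
    push_cast
    rw [hu s]
    ring
  have hz := h.eq_zero_of_lt j (fun s => u s - round p * x j s - round q * x (j + 1) s)
    (fun k => v k - round p * y j k - round q * y (j + 1) k)
    (by
      refine ((pi_norm_le_iff_of_nonneg ?_).2 fun s => ?_).trans_lt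
        (show (Xval x j + Xval x (j + 1)) / 2 < _ by linarith)
      · linarith [h.one_le_Xval j]
      · rw [hu', Real.norm_eq_abs]
        exact hcombine hp hq (h.abs_coord_le j s) (h.abs_coord_le (j + 1) s))
    (by
      refine ((pi_norm_le_iff_of_nonneg ?_).2 fun k => ?_).trans_lt
        (show (Lval ξ x y j + Lval ξ x y (j + 1)) / 2 < _ by linarith)
      · linarith [h.Lval_pos j, h.Lval_pos (j + 1)]
      · have : remainder ξ (fun s => u s - round p * x j s - round q * x (j + 1) s)
            (fun k => v k - round p * y j k - round q * y (j + 1) k) k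
            = (p - round p) * remainder ξ (x j) (y j) k
              + (q - round q) * remainder ξ (x (j + 1)) (y (j + 1)) k := by
          have := hv k
          simp only [remainder_apply, Fin.sum_univ_two] at this ⊢
          push_cast
          linear_combination this
        rw [this, Real.norm_eq_abs]
        exact hcombine hp hq (h.abs_remainder_le j k) (h.abs_remainder_le (j + 1) k))
  have h0 : (p - round p) * (x j 0 : ℝ) + (q - round q) * x (j + 1) 0 = 0 := by
    rw [← hu']
    exact_mod_cast congrFun hz 0
  have h1 : (p - round p) * (x j 1 : ℝ) + (q - round q) * x (j + 1) 1 = 0 := by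
    rw [← hu']
    exact_mod_cast congrFun hz 1
  have hdet' : ((x j 0 : ℝ) * x (j + 1) 1 - x j 1 * x (j + 1) 0) ≠ 0 := by exact_mod_cast hdet
  refine ⟨round p, ?_⟩
  have : (p - round p) * ((x j 0 : ℝ) * x (j + 1) 1 - x j 1 * x (j + 1) 0) = 0 := by
    linear_combination x (j + 1) 1 * h0 - x (j + 1) 0 * h1
  have := (mul_eq_zero.1 this).resolve_right hdet'
  linarith

/-- A bound for the wedge product of the best approximations `j + 1` and `j + 2` descends to the
pair `j`, `j + 1` as long as it is small enough. -/
lemma cross_le_of_cross_succ_le [Nonempty (Fin n)] (h : IsBestApproxSeq ξ x y) {M δ : ℝ}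
    (hM1 : 1 ≤ M) (j : ℕ) (hM : Lval ξ x y j ≤ M * Lval ξ x y (j + 1))
    (hδ : ∀ s k, |(x (j + 1) s : ℝ) * remainder ξ (x (j + 2)) (y (j + 2)) k
      - x (j + 2) s * remainder ξ (x (j + 1)) (y (j + 1)) k| ≤ δ)
    (hsmall : 18 * M * δ * Xval x (j + 1) < 1) (s : Fin 2) (k : Fin n) :
    |(x j s : ℝ) * remainder ξ (x (j + 1)) (y (j + 1)) k
      - x (j + 1) s * remainder ξ (x j) (y j) k| ≤ δ := by
  have hδ0 : 0 ≤ δ := (abs_nonneg _).trans (hδ s k)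
  have hbound := h.Lval_mul_Xval_le (j + 1) hδ
  have hX0 := h.one_le_Xval j
  have hX1 := h.one_le_Xval (j + 1)
  have hX2 := h.one_le_Xval (j + 2)
  have hX01 : Xval x j < Xval x (j + 1) := h.xStrictMono (Nat.lt_succ_self j)
  have hX12 : Xval x (j + 1) < Xval x (j + 2) := h.xStrictMono (Nat.lt_succ_self (j + 1))
  have hL01 : Lval ξ x y (j + 1) < Lval ξ x y j := h.lStrictAnti (Nat.lt_succ_self j)
  have hL12 : Lval ξ x y (j + 2) < Lval ξ x y (j + 1) := h.lStrictAnti (Nat.lt_succ_self (j + 1))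
  have hL0 := h.Lval_pos j
  have hL1 := h.Lval_pos (j + 1)
  have hL2 := h.Lval_pos (j + 2)
  have hXL : Xval x (j + 2) * Lval ξ x y j ≤ 3 * M * δ := by
    calc Xval x (j + 2) * Lval ξ x y j ≤ Xval x (j + 2) * (M * Lval ξ x y (j + 1)) := by gcongr
      _ = M * (Xval x (j + 2) * Lval ξ x y (j + 1)) := by ring
      _ ≤ M * (3 * δ) := by gcongr
      _ = 3 * M * δ := by ring
  have hMδ : 0 ≤ M * δ := by positivity
  have hMδ' : 18 * (M * δ) < 1 := by nlinarith
  have hdet0 : x j 0 * x (j + 1) 1 - x j 1 * x (j + 1) 0 ≠ 0 := by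
    apply h.det_ne_zero
    have : Xval x (j + 1) * Lval ξ x y j ≤ Xval x (j + 2) * Lval ξ x y j := by gcongr
    linarith
  have hdet1 : x (j + 1) 0 * x (j + 2) 1 - x (j + 1) 1 * x (j + 2) 0 ≠ 0 := by
    apply h.det_ne_zero
    have : Xval x (j + 2) * Lval ξ x y (j + 1) ≤ Xval x (j + 2) * Lval ξ x y j := by gcongr
    show 2 * (Xval x (j + 2) * _) < 1
    linarith
  have hterm : ∀ {i₁ i₂ i₃ : ℕ} (l : Fin n), Xval x i₁ * Xval x i₂ * Lval ξ x y i₃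
      ≤ Xval x (j + 1) * (Xval x (j + 2) * Lval ξ x y j) →
      |((x i₁ 0 * x i₂ 1 - x i₁ 1 * x i₂ 0 : ℤ) : ℝ) * remainder ξ (x i₃) (y i₃) l|
        ≤ 2 * (3 * M * δ * Xval x (j + 1)) := by
    intro i₁ i₂ i₃ l hle
    have hXi₁ := h.one_le_Xval i₁
    have hXi₂ := h.one_le_Xval i₂
    have e1 : |(x i₁ 0 : ℝ)| * |(x i₂ 1 : ℝ)| ≤ Xval x i₁ * Xval x i₂ :=
      mul_le_mul (h.abs_coord_le _ _) (h.abs_coord_le _ _) (abs_nonneg _) (by linarith)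
    have e2 : |(x i₁ 1 : ℝ)| * |(x i₂ 0 : ℝ)| ≤ Xval x i₁ * Xval x i₂ :=
      mul_le_mul (h.abs_coord_le _ _) (h.abs_coord_le _ _) (abs_nonneg _) (by linarith)
    have e3 := abs_sub ((x i₁ 0 : ℝ) * x i₂ 1) (x i₁ 1 * x i₂ 0)
    rw [abs_mul, abs_mul] at e3
    push_cast
    rw [abs_mul]
    calc _ ≤ (2 * (Xval x i₁ * Xval x i₂)) * Lval ξ x y i₃ :=
          mul_le_mul (by linarith) (h.abs_remainder_le _ _) (abs_nonneg _) (by positivity)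
      _ ≤ 2 * (Xval x (j + 1) * (Xval x (j + 2) * Lval ξ x y j)) := by linarith
      _ ≤ 2 * (Xval x (j + 1) * (3 * M * δ)) := by gcongr
      _ = _ := by ring
  have hzero : ∀ l, ((x (j + 1) 0 * x (j + 2) 1 - x (j + 1) 1 * x (j + 2) 0 : ℤ) : ℝ)
        * remainder ξ (x j) (y j) l
      + ((x (j + 2) 0 * x j 1 - x (j + 2) 1 * x j 0 : ℤ) : ℝ)
        * remainder ξ (x (j + 1)) (y (j + 1)) l
      + ((x j 0 * x (j + 1) 1 - x j 1 * x (j + 1) 0 : ℤ) : ℝ)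
        * remainder ξ (x (j + 2)) (y (j + 2)) l = 0 := by
    intro l
    apply remainder_combination_eq_zero
    · intro t
      fin_cases t <;> simp <;> ring
    · refine (abs_add_three _ _ _).trans_lt ?_
      have t1 := hterm (i₁ := j + 1) (i₂ := j + 2) (i₃ := j) l (by linarith)
      have t2 := hterm (i₁ := j + 2) (i₂ := j) (i₃ := j + 1) l (by
        calc _ ≤ Xval x (j + 2) * Xval x (j + 1) * Lval ξ x y j := by gcongr
          _ = _ := by ring)
      have t3 := hterm (i₁ := j) (i₂ := j + 1) (i₃ := j + 2) l (by
        calc _ ≤ Xval x (j + 2) * Xval x (j + 1) * Lval ξ x y j := by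
                gcongr
                · exact (hX01.trans hX12).le
                · exact (hL12.trans hL01).le
          _ = _ := by ring)
      linarith
  have hdet0' : ((x j 0 * x (j + 1) 1 - x j 1 * x (j + 1) 0 : ℤ) : ℝ) ≠ 0 := by
    exact_mod_cast hdet0
  have hdet1' : ((x (j + 1) 0 * x (j + 2) 1 - x (j + 1) 1 * x (j + 2) 0 : ℤ) : ℝ) ≠ 0 := by
    exact_mod_cast hdet1
  obtain ⟨p, hp⟩ : ∃ p : ℝ, p = -((x (j + 1) 0 * x (j + 2) 1 - x (j + 1) 1 * x (j + 2) 0 : ℤ) : ℝ)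
    / ((x j 0 * x (j + 1) 1 - x j 1 * x (j + 1) 0 : ℤ) : ℝ) := ⟨_, rfl⟩
  obtain ⟨q, hq⟩ : ∃ q : ℝ, q = -((x (j + 2) 0 * x j 1 - x (j + 2) 1 * x j 0 : ℤ) : ℝ)
    / ((x j 0 * x (j + 1) 1 - x j 1 * x (j + 1) 0 : ℤ) : ℝ) := ⟨_, rfl⟩
  have hp0 : p ≠ 0 := by
    rw [hp]
    exact div_ne_zero (neg_ne_zero.2 hdet1') hdet0'
  have hu : ∀ t, (x (j + 2) t : ℝ) = p * x j t + q * x (j + 1) t := by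
    intro t
    rw [hp, hq, div_mul_eq_mul_div, div_mul_eq_mul_div, ← add_div, eq_div_iff hdet0']
    fin_cases t <;> push_cast <;> simp <;> ring
  have hv : ∀ l, remainder ξ (x (j + 2)) (y (j + 2)) l = p * remainder ξ (x j) (y j) l
      + q * remainder ξ (x (j + 1)) (y (j + 1)) l := by
    intro l
    rw [hp, hq, div_mul_eq_mul_div, div_mul_eq_mul_div, ← add_div, eq_div_iff hdet0']
    linear_combination hzero l
  obtain ⟨a, ha⟩ := h.exists_int_eq j hdet0 hu hv
  have ha0 : a ≠ 0 := by
    rintro rfl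
    exact hp0 (by rw [← ha, Int.cast_zero])
  have hp1 : 1 ≤ |p| := by
    rw [← ha]
    exact_mod_cast Int.one_le_abs ha0
  have hcross := hδ s k
  rw [show (x (j + 1) s : ℝ) * remainder ξ (x (j + 2)) (y (j + 2)) k
      - x (j + 2) s * remainder ξ (x (j + 1)) (y (j + 1)) k
      = -p * (x j s * remainder ξ (x (j + 1)) (y (j + 1)) k
        - x (j + 1) s * remainder ξ (x j) (y j) k) by rw [hu, hv]; ring, abs_mul, abs_neg] at hcross
  exact (le_mul_of_one_le_left (abs_nonneg _) hp1).trans hcross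

/-- If the ratios `L_i / L_{i+1}` are bounded by `M`, an approximation much better than
`X_i ^ (-2)` forces `X_i` to be bounded. -/
lemma mul_Xval_le_of_small [Nonempty (Fin n)] (h : IsBestApproxSeq ξ x y) {M : ℝ}
    (hM1 : 1 ≤ M) (hM : ∀ i, Lval ξ x y i ≤ M * Lval ξ x y (i + 1)) (i : ℕ)
    (hsmall : 36 * M ^ 2 * (Xval x (i + 1) ^ 2 * Lval ξ x y (i + 1)) < 1) :
    Xval x 1 * Lval ξ x y 0 * Xval x (i + 1) ≤ 1 := by
  have hX := h.one_le_Xval (i + 1)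
  have hLpos := h.Lval_pos (i + 1)
  have hLi := h.Lval_pos i
  set δ : ℝ := 2 * (Xval x (i + 1) * Lval ξ x y i) with hδ
  have hδ0 : 0 < δ := by positivity
  have hδX : 18 * M * δ * Xval x (i + 1) < 1 := by
    refine lt_of_le_of_lt ?_ hsmall
    calc 18 * M * δ * Xval x (i + 1)
        = 36 * M * Xval x (i + 1) ^ 2 * Lval ξ x y i := by rw [hδ]; ring
      _ ≤ 36 * M * Xval x (i + 1) ^ 2 * (M * Lval ξ x y (i + 1)) := by
          gcongr
          exact hM i
      _ = _ := by ring
  have hdesc : ∀ j ≤ i, ∀ s k, |(x j s : ℝ) * remainder ξ (x (j + 1)) (y (j + 1)) k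
      - x (j + 1) s * remainder ξ (x j) (y j) k| ≤ δ := by
    intro j hj
    induction hj using Nat.decreasingInduction with
    | self =>
      intro s k
      refine (abs_sub _ _).trans ?_
      rw [abs_mul, abs_mul]
      have hXlt : Xval x i < Xval x (i + 1) := h.xStrictMono (Nat.lt_succ_self i)
      have hLlt : Lval ξ x y (i + 1) < Lval ξ x y i := h.lStrictAnti (Nat.lt_succ_self i)
      have e1 := mul_le_mul ((h.abs_coord_le i s).trans hXlt.le)
        ((h.abs_remainder_le (i + 1) k).trans hLlt.le) (abs_nonneg _) (by linarith)
      have e2 := mul_le_mul (h.abs_coord_le (i + 1) s) (h.abs_remainder_le i k)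
        (abs_nonneg _) (by linarith)
      linarith
    | @of_succ j hj ih =>
      refine h.cross_le_of_cross_succ_le hM1 j (hM j) ih (lt_of_le_of_lt ?_ hδX)
      have : Xval x (j + 1) ≤ Xval x (i + 1) := h.xStrictMono.monotone (by omega)
      gcongr
  have h0 := h.Lval_mul_Xval_le 0 (hdesc 0 (Nat.zero_le i))
  calc Xval x 1 * Lval ξ x y 0 * Xval x (i + 1) ≤ 3 * δ * Xval x (i + 1) := by
        gcongr
    _ ≤ 18 * M * δ * Xval x (i + 1) := by
        gcongr
        linarith
    _ ≤ 1 := hδX.le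

end Planar

end IsBestApproxSeq

end Auxiliary

/-- For `m = 2, n ≥ 2`: property (C) implies `ω(ξ) ≤ 2`. -/
theorem stmt_13 (n : ℕ) (hn : 2 ≤ n)
    (ξ : Matrix (Fin n) (Fin 2) ℝ) (hirr : TotallyIrrational ξ)
    (x : ℕ → Fin 2 → ℤ) (y : ℕ → Fin n → ℤ) (hxy : IsBestApproxSeq ξ x y)
    (hC : PropC ξ x y) :
    ordExp ξ x y ≤ (2 : EReal) := by
  obtain ⟨M, hM⟩ := hC
  have : Nonempty (Fin n) := ⟨⟨0, by omega⟩⟩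
  have hMle : ∀ i, Lval ξ x y i ≤ M * Lval ξ x y (i + 1) := fun i =>
    (div_le_iff₀ (hxy.Lval_pos (i + 1))).1 (hM i)
  have hM1 : 1 ≤ M := by
    refine le_trans ?_ (hM 0)
    rw [one_le_div (hxy.Lval_pos _)]
    exact (hxy.lStrictAnti (Nat.lt_succ_self 0)).le
  have hX := hxy.tendsto_Xval
  have hlarge : ∀ᶠ i in atTop, 1 ≤ 36 * M ^ 2 * (Xval x i ^ 2 * Lval ξ x y i) := by
    have hc : 0 < Xval x 1 * Lval ξ x y 0 :=
      mul_pos (zero_lt_one.trans_le (hxy.one_le_Xval 1)) (hxy.Lval_pos 0)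
    filter_upwards [(hX.const_mul_atTop hc).eventually_gt_atTop 1, eventually_ge_atTop 1]
      with i hi hi1
    obtain ⟨i, rfl⟩ := Nat.exists_eq_add_of_le' hi1
    by_contra! hlt
    exact absurd (hxy.mul_Xval_le_of_small hM1 hMle i hlt) (not_le.2 hi)
  have hlim : Tendsto (fun i => ((2 + Real.log (36 * M ^ 2) / Real.log (Xval x i) : ℝ) : EReal))
      atTop (nhds ((2 : ℝ) : EReal)) := by
    refine (continuous_coe_real_ereal.tendsto 2).comp ?_
    simpa using (tendsto_const_nhds (x := (2 : ℝ))).add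
      ((Real.tendsto_log_atTop.comp hX).const_div_atTop (Real.log (36 * M ^ 2)))
  have hle : ∀ᶠ i in atTop, ((-Real.log (Lval ξ x y i) / Real.log (Xval x i) : ℝ) : EReal)
      ≤ ((2 + Real.log (36 * M ^ 2) / Real.log (Xval x i) : ℝ) : EReal) := by
    filter_upwards [hlarge, hX.eventually_gt_atTop 1] with i hi hXi
    have hlog : 0 < Real.log (Xval x i) := Real.log_pos hXi
    have hL := hxy.Lval_pos i
    have hXpos : 0 < Xval x i := zero_lt_one.trans hXi
    have h0 := Real.log_nonneg hi
    rw [Real.log_mul (by positivity) (by positivity), Real.log_mul (by positivity) hL.ne',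
      Real.log_pow] at h0
    push_cast at h0
    rw [EReal.coe_le_coe_iff, div_le_iff₀ hlog, add_mul, div_mul_cancel₀ _ hlog.ne']
    linarith
  calc ordExp ξ x y ≤ _ := limsup_le_limsup hle
    _ = ((2 : ℝ) : EReal) := hlim.limsup_eq
    _ = 2 := rfl
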